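/- arXiv:1212.6964 — 2 statements merged into one kernel-verified Lean document; each statement's English description precedes it below -/
import Mathlib

section
/- Let δ ≤ 1/2 with δ ≥ 0, let a₀, b₀, a₁, b₁ be integers, m a nonnegative integer, and x = (a₀ + √2·b₀ + i(a₁ + √2·b₁)) / √2^m ∈ ℂ. Suppose |(a₀ + √2·b₀) − cos(θ)·√2^m| ≤ δ·√2^{m+1} and |(a₁ + √2·b₁) − sin(θ)·√2^m| ≤ δ·√2^{m+1} for some θ ∈ ℝ. Then Re(x·e^{−iθ}) ≥ 1 − 2δ ≥ 0, and (1 − |Re(x·e^{−iθ})|)·√2^m = ε_re + ε_im, where ε_re = cos(θ)·(√2^m·cos(θ) − (a₀ + b₀·√2)) and ε_im = sin(θ)·(√2^m·sin(θ) − (a₁ + b₁·√2)). -/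
open Complex

/-- The scaled real part of `((A + iB) / S) e^{-iθ}` is the inner product of `(A, B)` with
`(cos θ, sin θ)`. -/
theorem re_div_mul_exp_neg_mul_I_mul (A B S θ : ℝ) (hS : S ≠ 0) :
    (((A : ℂ) + I * (B : ℂ)) / (S : ℂ) * exp (-(θ : ℂ) * I)).re * S =
      A * Real.cos θ + B * Real.sin θ := by
  have h : ((A : ℂ) + I * (B : ℂ)) / (S : ℂ) * exp (-(θ : ℂ) * I) =
      (((A : ℂ) + I * (B : ℂ)) * exp (((-θ : ℝ) : ℂ) * I)) / (S : ℂ) := by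
    push_cast
    ring
  rw [h, div_ofReal_re, div_mul_cancel₀ _ hS, mul_re, exp_ofReal_mul_I_re, exp_ofReal_mul_I_im]
  simp

theorem abs_cos_add_abs_sin_le_sqrt_two (θ : ℝ) : |Real.cos θ| + |Real.sin θ| ≤ √2 := by
  apply Real.le_sqrt_of_sq_le
  nlinarith [sq_nonneg (|Real.cos θ| - |Real.sin θ|), sq_abs (Real.cos θ), sq_abs (Real.sin θ),
    Real.sin_sq_add_cos_sq θ]

/-- If `A` and `B` are within `√2 δ S` of `S cos θ` and `S sin θ`, then the component of `(A, B)`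
in direction `θ` is at least `(1 - 2δ) S`. -/
theorem one_sub_two_mul_mul_le_inner_of_abs_sub_le {A B S θ δ : ℝ}
    (hA : |A - Real.cos θ * S| ≤ δ * (S * √2)) (hB : |B - Real.sin θ * S| ≤ δ * (S * √2)) :
    (1 - 2 * δ) * S ≤ A * Real.cos θ + B * Real.sin θ := by
  have hnonneg : 0 ≤ δ * (S * √2) := (abs_nonneg _).trans hA
  have hc : |(A - Real.cos θ * S) * Real.cos θ| ≤ δ * (S * √2) * |Real.cos θ| := by
    rw [abs_mul]
    gcongr
  have hs : |(B - Real.sin θ * S) * Real.sin θ| ≤ δ * (S * √2) * |Real.sin θ| := by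
    rw [abs_mul]
    gcongr
  have hsum : δ * (S * √2) * (|Real.cos θ| + |Real.sin θ|) ≤ 2 * δ * S :=
    calc δ * (S * √2) * (|Real.cos θ| + |Real.sin θ|) ≤ δ * (S * √2) * √2 := by
          gcongr
          exact abs_cos_add_abs_sin_le_sqrt_two θ
      _ = δ * S * (√2 * √2) := by ring
      _ = 2 * δ * S := by
          rw [Real.mul_self_sqrt zero_le_two]
          ring
  have hexpand : A * Real.cos θ + B * Real.sin θ =
      S + (A - Real.cos θ * S) * Real.cos θ + (B - Real.sin θ * S) * Real.sin θ := by
    linear_combination S * Real.sin_sq_add_cos_sq θ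
  linarith [neg_le_of_abs_le hc, neg_le_of_abs_le hs]

/-- if 0 ≤ δ ≤ 1/2 and the real and imaginary parts of
x = (a₀ + √2 b₀ + i(a₁ + √2 b₁))/√2^m approximate cos θ, sin θ to within
δ√2^{m+1}, then Re(x e^{−iθ}) ≥ 1 − 2δ ≥ 0 and
(1 − |Re(x e^{−iθ})|)·√2^m = ε_re + ε_im. -/
theorem stmt_7 (a₀ b₀ a₁ b₁ : ℤ) (m : ℕ) (θ δ : ℝ) (hδ0 : 0 ≤ δ) (hδ : δ ≤ 1 / 2)
    (x : ℂ)
    (hx : x = (((a₀ : ℂ) + (Real.sqrt 2 : ℂ) * (b₀ : ℂ)) +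
        Complex.I * ((a₁ : ℂ) + (Real.sqrt 2 : ℂ) * (b₁ : ℂ))) / (Real.sqrt 2 : ℂ) ^ m)
    (hre : |((a₀ : ℝ) + Real.sqrt 2 * (b₀ : ℝ)) - Real.cos θ * Real.sqrt 2 ^ m| ≤
      δ * Real.sqrt 2 ^ (m + 1))
    (him : |((a₁ : ℝ) + Real.sqrt 2 * (b₁ : ℝ)) - Real.sin θ * Real.sqrt 2 ^ m| ≤
      δ * Real.sqrt 2 ^ (m + 1)) :
    1 - 2 * δ ≤ (x * Complex.exp (-(θ : ℂ) * Complex.I)).re ∧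
    0 ≤ 1 - 2 * δ ∧
    (1 - |(x * Complex.exp (-(θ : ℂ) * Complex.I)).re|) * Real.sqrt 2 ^ m =
      Real.cos θ * (Real.sqrt 2 ^ m * Real.cos θ - ((a₀ : ℝ) + (b₀ : ℝ) * Real.sqrt 2)) +
      Real.sin θ * (Real.sqrt 2 ^ m * Real.sin θ - ((a₁ : ℝ) + (b₁ : ℝ) * Real.sqrt 2)) := by
  have hS : 0 < √2 ^ m := by positivity
  have hre_mul := re_div_mul_exp_neg_mul_I_mul (a₀ + √2 * b₀) (a₁ + √2 * b₁) (√2 ^ m) θ hS.ne'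
  push_cast at hre_mul
  rw [← hx] at hre_mul
  rw [pow_succ] at hre him
  have hlower : 1 - 2 * δ ≤ (x * exp (-(θ : ℂ) * I)).re := by
    refine le_of_mul_le_mul_right ?_ hS
    rw [hre_mul]
    exact one_sub_two_mul_mul_le_inner_of_abs_sub_le hre him
  have hδ' : 0 ≤ 1 - 2 * δ := by linarith
  refine ⟨hlower, hδ', ?_⟩
  rw [abs_of_nonneg (hδ'.trans hlower)]
  linear_combination -hre_mul - √2 ^ m * Real.sin_sq_add_cos_sq θ
end

section
/- Let a₀, a₁, b₀, b₁ be integers, m an integer, and let t = ((a₀² + a₁²) + 2(b₀² + b₁²) + 2√2·(a₀b₀ + a₁b₁)) / 2^m (i.e., t = |x|² for x = (a₀ + √2·b₀ + i(a₁ + √2·b₁))/√2^m). Then: (i) if exactly one of a₀, a₁ is odd, sde(t) = 2m; (ii) if a₀ and a₁ are both odd and b₀, b₁ have different parity, sde(t) = 2m − 3; (iii) if a₀ and a₁ are both odd and b₀, b₁ have the same parity, sde(t) = 2m − 2. -/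
noncomputable section

/-- Smallest denominator exponent: least s with √2^s · t ∈ ℤ[√2]. -/
def sde (t : ℝ) : ℤ :=
  sInf {s : ℤ | ∃ a b : ℤ, Real.sqrt 2 ^ s * t = (a : ℝ) + (b : ℝ) * Real.sqrt 2}

lemma int_add_int_mul_sqrt_two_inj {p q a b : ℤ}
    (h : (p : ℝ) + q * √2 = a + b * √2) : p = a := by
  by_contra hne
  have hqb : q ≠ b := by
    rintro rfl
    exact hne (by exact_mod_cast add_right_cancel h)
  have hb : ((b - q : ℤ) : ℝ) ≠ 0 := by
    exact_mod_cast sub_ne_zero.mpr hqb.symm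
  refine irrational_sqrt_two.ne_rat (((p - a : ℤ) : ℚ) / ((b - q : ℤ) : ℚ)) ?_
  rw [Rat.cast_div, Rat.cast_intCast, Rat.cast_intCast, eq_div_iff hb]
  push_cast
  linarith

lemma exists_sqrt_two_pow_mul_eq (n : ℕ) (a b : ℤ) :
    ∃ c d : ℤ, √2 ^ n * ((a : ℝ) + b * √2) = c + d * √2 := by
  induction n with
  | zero => exact ⟨a, b, by simp⟩
  | succ n ih =>
    obtain ⟨c, d, h⟩ := ih
    have h2 : √2 * √2 = (2 : ℝ) := Real.mul_self_sqrt (by norm_num)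
    refine ⟨2 * d, c, ?_⟩
    push_cast
    linear_combination √2 * h + (d : ℝ) * h2

/-- An odd `p` makes `p + q√2` indivisible by `√2` in `ℤ[√2]`, so the exponent is exactly `-k`. -/
lemma sde_sqrt_two_zpow_mul (k p q : ℤ) (hp : Odd p) :
    sde (√2 ^ k * ((p : ℝ) + q * √2)) = -k := by
  have h0 : √2 ≠ (0 : ℝ) := by positivity
  have h2 : √2 * √2 = (2 : ℝ) := Real.mul_self_sqrt (by norm_num)
  refine IsLeast.csInf_eq ⟨⟨p, q, ?_⟩, ?_⟩
  · rw [← mul_assoc, ← zpow_add₀ h0, neg_add_cancel, zpow_zero, one_mul]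
  · rintro s ⟨a, b, h⟩
    by_contra! hs
    obtain ⟨n, hn⟩ := Int.eq_ofNat_of_zero_le (show 0 ≤ -k - s - 1 by omega)
    obtain ⟨c, d, hcd⟩ := exists_sqrt_two_pow_mul_eq n a b
    have hone : √2 ^ n * √2 * (√2 ^ s * √2 ^ k) = 1 := by
      rw [← zpow_natCast, ← zpow_add_one₀ h0, ← zpow_add₀ h0, ← zpow_add₀ h0,
        show (n : ℤ) + 1 + (s + k) = 0 by omega, zpow_zero]
    have key : (p : ℝ) + q * √2 = (2 * d : ℤ) + c * √2 := by
      push_cast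
      linear_combination -((p : ℝ) + q * √2) * hone + √2 ^ n * √2 * h + √2 * hcd + (d : ℝ) * h2
    rw [int_add_int_mul_sqrt_two_inj key] at hp
    exact (Int.not_odd_iff_even.mpr (even_two_mul d)) hp

/-- sde of t = ((a₀²+a₁²) + 2(b₀²+b₁²) + 2√2(a₀b₀+a₁b₁))/2^m
according to the parities of a₀, a₁, b₀, b₁. -/
theorem stmt_10 (a₀ a₁ b₀ b₁ : ℤ) (m : ℤ) (t : ℝ)
    (ht : t = (((a₀ ^ 2 + a₁ ^ 2 : ℤ) : ℝ) + 2 * ((b₀ ^ 2 + b₁ ^ 2 : ℤ) : ℝ) +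
        2 * Real.sqrt 2 * ((a₀ * b₀ + a₁ * b₁ : ℤ) : ℝ)) / (2 : ℝ) ^ m) :
    ((Odd a₀ ∧ Even a₁) ∨ (Even a₀ ∧ Odd a₁) → sde t = 2 * m) ∧
    (Odd a₀ → Odd a₁ → ((Even b₀ ∧ Odd b₁) ∨ (Odd b₀ ∧ Even b₁)) →
      sde t = 2 * m - 3) ∧
    (Odd a₀ → Odd a₁ → ((Even b₀ ∧ Even b₁) ∨ (Odd b₀ ∧ Odd b₁)) →
      sde t = 2 * m - 2) := by
  have h0 : √2 ≠ (0 : ℝ) := by positivity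
  have h2 : √2 ^ 2 = (2 : ℝ) := Real.sq_sqrt (by norm_num)
  have hm : √2 ^ (-(2 * m)) = ((2 : ℝ) ^ m)⁻¹ := by
    rw [zpow_neg, zpow_mul, zpow_ofNat, h2]
  have main : ∀ (j : ℕ) (p q : ℤ), Odd p →
      (((a₀ ^ 2 + a₁ ^ 2 : ℤ) : ℝ) + 2 * ((b₀ ^ 2 + b₁ ^ 2 : ℤ) : ℝ) +
        2 * √2 * ((a₀ * b₀ + a₁ * b₁ : ℤ) : ℝ)) = √2 ^ j * ((p : ℝ) + q * √2) →
      sde t = 2 * m - j := by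
    intro j p q hp h
    have ht' : t = √2 ^ (-(2 * m) + j) * ((p : ℝ) + q * √2) := by
      rw [ht, h, zpow_add₀ h0, hm, zpow_natCast]
      ring
    rw [ht', sde_sqrt_two_zpow_mul _ _ _ hp]
    ring
  refine ⟨fun h => ?_, fun ha₀ ha₁ h => ?_, fun ha₀ ha₁ h => ?_⟩
  · have hodd : Odd (a₀ ^ 2 + a₁ ^ 2 + 2 * (b₀ ^ 2 + b₁ ^ 2)) := by
      simp only [← Int.not_even_iff_odd, Int.even_add, Int.even_mul, Int.even_pow, even_two] at h ⊢
      tauto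
    rw [main 0 _ (2 * (a₀ * b₀ + a₁ * b₁)) hodd (by push_cast; ring)]
    simp
  · have hodd : Odd (a₀ * b₀ + a₁ * b₁) := by
      simp only [← Int.not_even_iff_odd, Int.even_add, Int.even_mul] at ha₀ ha₁ h ⊢
      tauto
    have hdvd : ∃ r, a₀ ^ 2 + a₁ ^ 2 + 2 * (b₀ ^ 2 + b₁ ^ 2) = 4 * r := by
      obtain ⟨x, rfl⟩ := ha₀
      obtain ⟨y, rfl⟩ := ha₁
      have hb : Odd (b₀ ^ 2 + b₁ ^ 2) := by
        simp only [← Int.not_even_iff_odd, Int.even_add, Int.even_pow] at h ⊢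
        tauto
      obtain ⟨z, hz⟩ := hb
      exact ⟨x ^ 2 + x + y ^ 2 + y + z + 1, by rw [hz]; ring⟩
    obtain ⟨r, hr⟩ := hdvd
    have hr' := congrArg (Int.cast : ℤ → ℝ) hr
    push_cast at hr'
    refine main 3 _ r hodd ?_
    push_cast
    linear_combination hr' -
      (√2 * ((a₀ : ℝ) * b₀ + a₁ * b₁) + r * √2 ^ 2 + 2 * r) * h2
  · have hodd : ∃ r, Odd r ∧ a₀ ^ 2 + a₁ ^ 2 + 2 * (b₀ ^ 2 + b₁ ^ 2) = 2 * r := by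
      obtain ⟨x, rfl⟩ := ha₀
      obtain ⟨y, rfl⟩ := ha₁
      have hb : Even (b₀ ^ 2 + b₁ ^ 2) := by
        simp only [← Int.not_even_iff_odd, Int.even_add, Int.even_pow] at h ⊢
        tauto
      obtain ⟨z, hz⟩ := hb
      exact ⟨_, ⟨x ^ 2 + x + y ^ 2 + y + z, rfl⟩, by rw [hz]; ring⟩
    obtain ⟨r, hr, hr'⟩ := hodd
    have hr' := congrArg (Int.cast : ℤ → ℝ) hr'
    push_cast at hr'
    refine main 2 r (a₀ * b₀ + a₁ * b₁) hr ?_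
    push_cast
    linear_combination hr' - ((r : ℝ) + (a₀ * b₀ + a₁ * b₁) * √2) * h2


end
end
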